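/- Let ν > 0 and let u, w : ℝ² → ℝ² be smooth (C^∞) compactly supported vector fields, and set z := u − w. Then ν · ‖∇z‖_{L²}² + b̂(u, u, z) − b̂(w, w, z) + (27/(2ν³)) · ‖w‖_{L⁴}⁴ · ‖z‖_{L²}² ≥ (ν/2) · ‖∇z‖_{L²}². -/

import Mathlib

open MeasureTheory

/-- Partial derivative `∂_j f` of a scalar function on `ℝ²`. -/
noncomputable def pderiv2 (j : Fin 2) (f : (Fin 2 → ℝ) → ℝ) (x : Fin 2 → ℝ) : ℝ :=
  fderiv ℝ f x (Pi.single j 1)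

/-- The trilinear form
`b̂(u,v,w) = ∫ ((u·∇)v)·w + (1/2) ∫ (div u)(v·w)` on `ℝ²`. -/
noncomputable def bhat (u v w : (Fin 2 → ℝ) → (Fin 2 → ℝ)) : ℝ :=
  (∫ x : Fin 2 → ℝ,
      ∑ i : Fin 2, (∑ j : Fin 2, u x j * pderiv2 j (fun y => v y i) x) * w x i) +
  (1 / 2) * ∫ x : Fin 2 → ℝ,
      (∑ j : Fin 2, pderiv2 j (fun y => u y j) x) * (∑ i : Fin 2, v x i * w x i)

/-- The squared `L²`-norm of a vector field on `ℝ²`. -/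
noncomputable def l2normSq (u : (Fin 2 → ℝ) → (Fin 2 → ℝ)) : ℝ :=
  ∫ x : Fin 2 → ℝ, ∑ i : Fin 2, (u x i) ^ 2

/-- The squared `L²`-norm of the gradient of a vector field on `ℝ²`. -/
noncomputable def gradL2normSq (u : (Fin 2 → ℝ) → (Fin 2 → ℝ)) : ℝ :=
  ∑ i : Fin 2, ∑ j : Fin 2, ∫ x : Fin 2 → ℝ, (pderiv2 j (fun y => u y i) x) ^ 2

/-- The fourth power of the `L⁴`-norm of a vector field on `ℝ²`. -/
noncomputable def l4normP4 (u : (Fin 2 → ℝ) → (Fin 2 → ℝ)) : ℝ :=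
  ∫ x : Fin 2 → ℝ, (∑ i : Fin 2, (u x i) ^ 2) ^ 2

lemma continuous_pderiv2 {f : (Fin 2 → ℝ) → ℝ} (hf : ContDiff ℝ 1 f) (j : Fin 2) :
    Continuous (pderiv2 j f) :=
  (hf.continuous_fderiv one_ne_zero).clm_apply continuous_const

lemma pderiv2_eq_zero_of_notMem_tsupport {f : (Fin 2 → ℝ) → ℝ} {x : Fin 2 → ℝ}
    (hx : x ∉ tsupport f) (j : Fin 2) : pderiv2 j f x = 0 := by
  have h := image_eq_zero_of_notMem_tsupport (fun h => hx (tsupport_fderiv_subset ℝ h))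
  simp [pderiv2, h]

lemma pderiv2_mul {f g : (Fin 2 → ℝ) → ℝ} (hf : Differentiable ℝ f) (hg : Differentiable ℝ g)
    (j : Fin 2) (x : Fin 2 → ℝ) :
    pderiv2 j (fun y => f y * g y) x = f x * pderiv2 j g x + pderiv2 j f x * g x := by
  simp only [pderiv2]
  rw [fderiv_fun_mul (hf x) (hg x)]
  simp [mul_comm]

lemma pderiv2_add {f g : (Fin 2 → ℝ) → ℝ} (hf : Differentiable ℝ f) (hg : Differentiable ℝ g)
    (j : Fin 2) (x : Fin 2 → ℝ) :
    pderiv2 j (fun y => f y + g y) x = pderiv2 j f x + pderiv2 j g x := by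
  simp only [pderiv2]
  rw [fderiv_fun_add (hf x) (hg x)]
  simp

lemma pderiv2_sub {f g : (Fin 2 → ℝ) → ℝ} (hf : Differentiable ℝ f) (hg : Differentiable ℝ g)
    (j : Fin 2) (x : Fin 2 → ℝ) :
    pderiv2 j (fun y => f y - g y) x = pderiv2 j f x - pderiv2 j g x := by
  simp only [pderiv2]
  rw [fderiv_fun_sub (hf x) (hg x)]
  simp

lemma integral_pderiv2_eq_zero {f : (Fin 2 → ℝ) → ℝ} (hf : ContDiff ℝ 1 f)
    (hfs : HasCompactSupport f) (j : Fin 2) : ∫ x, pderiv2 j f x = 0 := by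
  have hd : Integrable (fun x => fderiv ℝ f x (Pi.single j 1)) :=
    (continuous_pderiv2 hf j).integrable_of_hasCompactSupport
      (hfs.fderiv_apply (𝕜 := ℝ) (Pi.single j 1))
  have hi : Integrable f := hf.continuous.integrable_of_hasCompactSupport hfs
  have h := integral_mul_fderiv_eq_neg_fderiv_mul_of_integrable (μ := volume)
    (f := fun _ : Fin 2 → ℝ => (1 : ℝ)) (g := f) (v := Pi.single j 1)
    (by simp) (by simpa using hd) (by simpa using hi)
    (fun x _ => by fun_prop) (fun x _ => hf.differentiable one_ne_zero x)
  simpa [pderiv2] using h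

/-- Half of the total variation bounds a compactly supported function on the line. -/
lemma two_mul_abs_le_integral_abs_deriv {g : ℝ → ℝ} (hg : ContDiff ℝ 1 g)
    (hgs : HasCompactSupport g) (b : ℝ) : 2 * |g b| ≤ ∫ t, |deriv g t| := by
  have hi : Integrable (deriv g) :=
    (hg.continuous_deriv le_rfl).integrable_of_hasCompactSupport hgs.deriv
  have h1 : |g b| ≤ ∫ t in Set.Iic b, |deriv g t| := by
    rw [← hgs.integral_Iic_deriv_eq hg b]
    exact abs_integral_le_integral_abs
  have h2 : |g b| ≤ ∫ t in Set.Ioi b, |deriv g t| := by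
    rw [← abs_neg, ← hgs.integral_Ioi_deriv_eq hg b]
    exact abs_integral_le_integral_abs
  have h3 := intervalIntegral.integral_Iic_add_Ioi (b := b) hi.abs.integrableOn hi.abs.integrableOn
  linarith

lemma HasCompactSupport.fun_sq {f : (Fin 2 → ℝ) → ℝ} (hfs : HasCompactSupport f) :
    HasCompactSupport (fun x => f x ^ 2) :=
  HasCompactSupport.intro hfs fun x hx => by simp [image_eq_zero_of_notMem_tsupport hx]

lemma integrable_sq_of_hasCompactSupport {f : (Fin 2 → ℝ) → ℝ} (hf : Continuous f)
    (hfs : HasCompactSupport f) : Integrable (fun x => f x ^ 2) :=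
  Continuous.integrable_of_hasCompactSupport (by fun_prop) hfs.fun_sq

lemma ofReal_abs_le_lintegral_update {q F : (Fin 2 → ℝ) → ℝ} (hq : ContDiff ℝ 1 q)
    (hqs : HasCompactSupport q) (hF : Continuous F) (hFs : HasCompactSupport F)
    (hqF : ∀ j x, |pderiv2 j q x| ≤ 2 * F x) (x : Fin 2 → ℝ) (j : Fin 2) :
    ENNReal.ofReal |q x| ≤ ∫⁻ t, ENNReal.ofReal (F (Function.update x j t)) := by
  have hup : Continuous (Function.update x j) := continuous_const.update j continuous_id
  have hFi : Integrable (fun t => F (Function.update x j t)) :=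
    (hF.comp hup).integrable_of_hasCompactSupport
      (hFs.comp_isClosedEmbedding (isClosedEmbedding_update x j))
  have hg : ContDiff ℝ 1 (q ∘ Function.update x j) := hq.comp (contDiff_update 1 x j)
  have hgs : HasCompactSupport (q ∘ Function.update x j) :=
    hqs.comp_isClosedEmbedding (isClosedEmbedding_update x j)
  have hder (t : ℝ) : deriv (q ∘ Function.update x j) t = pderiv2 j q (Function.update x j t) := by
    rw [fderiv_comp_deriv _ (hq.differentiable one_ne_zero).differentiableAt
      (hasDerivAt_update x j t).differentiableAt, deriv_update]
    rfl
  have h := two_mul_abs_le_integral_abs_deriv hg hgs (x j)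
  have hle : ∫ t, |deriv (q ∘ Function.update x j) t| ≤ ∫ t, 2 * F (Function.update x j t) := by
    refine integral_mono ?_ (hFi.const_mul 2) fun t => ?_
    · exact ((hg.continuous_deriv le_rfl).integrable_of_hasCompactSupport hgs.deriv).abs
    · simpa only [hder t] using hqF j (Function.update x j t)
  rw [integral_const_mul] at hle
  simp only [Function.comp_apply, Function.update_eq_self] at h
  rw [← ofReal_integral_eq_lintegral_ofReal hFi (Filter.Eventually.of_forall fun t => ?_)]
  · exact ENNReal.ofReal_le_ofReal (by linarith)
  · have := (abs_nonneg _).trans (hqF j (Function.update x j t))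
    simp only [Pi.zero_apply]
    linarith

/-- The planar Gagliardo–Nirenberg inequality for a function whose partial derivatives are
bounded by a common majorant. -/
lemma integral_sq_le_sq_integral_of_abs_pderiv2_le {q F : (Fin 2 → ℝ) → ℝ} (hq : ContDiff ℝ 1 q)
    (hqs : HasCompactSupport q) (hF : Continuous F) (hFs : HasCompactSupport F)
    (hqF : ∀ j x, |pderiv2 j q x| ≤ 2 * F x) :
    ∫ x, q x ^ 2 ≤ (∫ x, F x) ^ 2 := by
  have hF0 (x) : 0 ≤ F x := by
    have := (abs_nonneg _).trans (hqF 0 x)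
    linarith
  have hFi : Integrable F := hF.integrable_of_hasCompactSupport hFs
  have hgrid := lintegral_prod_lintegral_pow_le (ι := Fin 2) (A := fun _ => ℝ)
    (fun _ => volume) (p := 2)
    (by rw [Fintype.card_fin]; exact_mod_cast Real.HolderConjugate.two_two)
    (f := fun x => ENNReal.ofReal (F x)) (by fun_prop)
  have hq2 : Integrable (fun x => q x ^ 2) :=
    integrable_sq_of_hasCompactSupport hq.continuous hqs
  have key : ENNReal.ofReal (∫ x, q x ^ 2) ≤ ENNReal.ofReal ((∫ x, F x) ^ 2) := by
    rw [ofReal_integral_eq_lintegral_ofReal hq2 (Filter.Eventually.of_forall fun x => sq_nonneg _),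
      ENNReal.ofReal_pow (integral_nonneg hF0),
      ofReal_integral_eq_lintegral_ofReal hFi (Filter.Eventually.of_forall hF0)]
    refine le_trans (lintegral_mono fun x => ?_) (hgrid.trans_eq ?_)
    · rw [Fin.prod_univ_two, ← sq_abs, ENNReal.ofReal_pow (abs_nonneg _), sq]
      norm_num
      exact mul_le_mul' (ofReal_abs_le_lintegral_update hq hqs hF hFs hqF x 0)
        (ofReal_abs_le_lintegral_update hq hqs hF hFs hqF x 1)
    · exact ENNReal.rpow_two _
  exact (ENNReal.ofReal_le_ofReal_iff (sq_nonneg _)).1 key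

lemma sq_integral_mul_le {f g : (Fin 2 → ℝ) → ℝ} (hf : Continuous f) (hfs : HasCompactSupport f)
    (hg : Continuous g) (hgs : HasCompactSupport g) :
    (∫ x, f x * g x) ^ 2 ≤ (∫ x, f x ^ 2) * ∫ x, g x ^ 2 := by
  have hff : Integrable (fun x => f x ^ 2) :=
    integrable_sq_of_hasCompactSupport hf hfs
  have hgg : Integrable (fun x => g x ^ 2) :=
    integrable_sq_of_hasCompactSupport hg hgs
  have hfg : Integrable (fun x => f x * g x) :=
    (hf.mul hg).integrable_of_hasCompactSupport hgs.mul_left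
  have h (s : ℝ) : 0 ≤ (∫ x, f x ^ 2) * (s * s) + 2 * (∫ x, f x * g x) * s + ∫ x, g x ^ 2 := by
    calc 0 ≤ ∫ x, (s * f x + g x) ^ 2 := integral_nonneg fun x => sq_nonneg _
      _ = ∫ x, (s * s * f x ^ 2 + 2 * s * (f x * g x) + g x ^ 2) := by
        congr 1; ext x; ring
      _ = _ := by
        rw [integral_add (by exact (hff.const_mul _).add (hfg.const_mul _)) hgg,
          integral_add (hff.const_mul _) (hfg.const_mul _), integral_const_mul,
          integral_const_mul]
        ring
  have := discrim_le_zero h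
  rw [discrim] at this
  linarith

/-- The Euclidean length of a vector field on the plane. -/
noncomputable def vecLength (u : (Fin 2 → ℝ) → (Fin 2 → ℝ)) (x : Fin 2 → ℝ) : ℝ :=
  √(∑ i : Fin 2, u x i ^ 2)

/-- The Frobenius norm of the gradient of a vector field on the plane. -/
noncomputable def gradLength (u : (Fin 2 → ℝ) → (Fin 2 → ℝ)) (x : Fin 2 → ℝ) : ℝ :=
  √(∑ i : Fin 2, ∑ j : Fin 2, pderiv2 j (fun y => u y i) x ^ 2)

lemma vecLength_sq (u : (Fin 2 → ℝ) → (Fin 2 → ℝ)) (x : Fin 2 → ℝ) :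
    vecLength u x ^ 2 = ∑ i : Fin 2, u x i ^ 2 :=
  Real.sq_sqrt (by positivity)

lemma gradLength_sq (u : (Fin 2 → ℝ) → (Fin 2 → ℝ)) (x : Fin 2 → ℝ) :
    gradLength u x ^ 2 = ∑ i : Fin 2, ∑ j : Fin 2, pderiv2 j (fun y => u y i) x ^ 2 :=
  Real.sq_sqrt (by positivity)

lemma contDiff_component {u : (Fin 2 → ℝ) → (Fin 2 → ℝ)} (hu : ContDiff ℝ 1 u) (i : Fin 2) :
    ContDiff ℝ 1 (fun y => u y i) :=
  contDiff_pi.1 hu i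

lemma continuous_pderiv2_component {u : (Fin 2 → ℝ) → (Fin 2 → ℝ)} (hu : ContDiff ℝ 1 u)
    (i j : Fin 2) : Continuous (pderiv2 j (fun y => u y i)) :=
  continuous_pderiv2 (contDiff_component hu i) j

lemma pderiv2_component_eq_zero {u : (Fin 2 → ℝ) → (Fin 2 → ℝ)} {x : Fin 2 → ℝ}
    (hx : x ∉ tsupport u) (i j : Fin 2) : pderiv2 j (fun y => u y i) x = 0 :=
  pderiv2_eq_zero_of_notMem_tsupport
    (fun h => hx (tsupport_comp_subset (g := fun v : Fin 2 → ℝ => v i) rfl u h)) j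

lemma continuous_vecLength {u : (Fin 2 → ℝ) → (Fin 2 → ℝ)} (hu : Continuous u) :
    Continuous (vecLength u) := by
  unfold vecLength
  fun_prop

lemma continuous_gradLength {u : (Fin 2 → ℝ) → (Fin 2 → ℝ)} (hu : ContDiff ℝ 1 u) :
    Continuous (gradLength u) := by
  have := continuous_pderiv2_component hu
  unfold gradLength
  fun_prop

lemma hasCompactSupport_vecLength {u : (Fin 2 → ℝ) → (Fin 2 → ℝ)} (hus : HasCompactSupport u) :
    HasCompactSupport (vecLength u) :=
  HasCompactSupport.intro hus fun x hx => by
    simp [vecLength, image_eq_zero_of_notMem_tsupport hx]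

lemma hasCompactSupport_gradLength {u : (Fin 2 → ℝ) → (Fin 2 → ℝ)} (hus : HasCompactSupport u) :
    HasCompactSupport (gradLength u) :=
  HasCompactSupport.intro hus fun x hx => by
    simp [gradLength, pderiv2_component_eq_zero hx]

lemma l2normSq_eq_integral_vecLength_sq (u : (Fin 2 → ℝ) → (Fin 2 → ℝ)) :
    l2normSq u = ∫ x, vecLength u x ^ 2 := by
  simp only [l2normSq, vecLength_sq]

lemma l4normP4_eq_integral_vecLength_sq_sq (u : (Fin 2 → ℝ) → (Fin 2 → ℝ)) :
    l4normP4 u = ∫ x, (vecLength u x ^ 2) ^ 2 := by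
  simp only [l4normP4, vecLength_sq]

lemma gradL2normSq_eq_integral_gradLength_sq {u : (Fin 2 → ℝ) → (Fin 2 → ℝ)}
    (hu : ContDiff ℝ 1 u) (hus : HasCompactSupport u) :
    gradL2normSq u = ∫ x, gradLength u x ^ 2 := by
  have hi (i j : Fin 2) : Integrable (fun x => pderiv2 j (fun y => u y i) x ^ 2) :=
    ((continuous_pderiv2_component hu i j).pow 2).integrable_of_hasCompactSupport
      (HasCompactSupport.intro hus fun x hx => by simp [pderiv2_component_eq_zero hx])
  simp only [gradL2normSq, gradLength_sq]
  rw [integral_finsetSum _ fun i _ => integrable_finsetSum _ fun j _ => hi i j]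
  exact Finset.sum_congr rfl fun i _ => (integral_finsetSum _ fun j _ => hi i j).symm

/-- **Ladyzhenskaya's inequality** in the plane. -/
lemma l4normP4_le {z : (Fin 2 → ℝ) → (Fin 2 → ℝ)} (hz : ContDiff ℝ 1 z)
    (hzs : HasCompactSupport z) : l4normP4 z ≤ l2normSq z * gradL2normSq z := by
  have hc := contDiff_component hz
  have hd (i) : Differentiable ℝ (fun y => z y i) := (hc i).differentiable one_ne_zero
  rw [l2normSq_eq_integral_vecLength_sq, gradL2normSq_eq_integral_gradLength_sq hz hzs]
  refine le_trans ?_ (sq_integral_mul_le (continuous_vecLength hz.continuous)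
    (hasCompactSupport_vecLength hzs) (continuous_gradLength hz) (hasCompactSupport_gradLength hzs))
  refine integral_sq_le_sq_integral_of_abs_pderiv2_le (by fun_prop)
    (HasCompactSupport.intro hzs fun x hx => by simp [image_eq_zero_of_notMem_tsupport hx])
    ((continuous_vecLength hz.continuous).mul (continuous_gradLength hz))
    (hasCompactSupport_gradLength hzs).mul_left fun j x => ?_
  have hp : pderiv2 j (fun y => ∑ i : Fin 2, z y i ^ 2) x =
      2 * ∑ i : Fin 2, z x i * pderiv2 j (fun y => z y i) x := by
    simp only [Fin.sum_univ_two, sq]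
    rw [pderiv2_add (by fun_prop) (by fun_prop), pderiv2_mul (hd 0) (hd 0),
      pderiv2_mul (hd 1) (hd 1)]
    ring
  rw [hp, abs_mul, abs_two]
  gcongr
  refine abs_le_of_sq_le_sq ?_ (mul_nonneg (Real.sqrt_nonneg _) (Real.sqrt_nonneg _))
  rw [mul_pow, vecLength_sq, gradLength_sq]
  refine (Finset.sum_mul_sq_le_sq_mul_sq _ _ _).trans ?_
  gcongr with i
  exact Finset.single_le_sum (f := fun j => pderiv2 j (fun y => z y i) x ^ 2)
    (fun _ _ => sq_nonneg _) (Finset.mem_univ j)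

/-- The integrand of the trilinear form. -/
noncomputable def bhatDensity (u v w : (Fin 2 → ℝ) → (Fin 2 → ℝ)) (x : Fin 2 → ℝ) : ℝ :=
  ∑ i : Fin 2, (∑ j : Fin 2, u x j * pderiv2 j (fun y => v y i) x) * w x i +
    (1 / 2) * ((∑ j : Fin 2, pderiv2 j (fun y => u y j) x) * (∑ i : Fin 2, v x i * w x i))

lemma continuous_bhatDensity {u v w : (Fin 2 → ℝ) → (Fin 2 → ℝ)} (hu : ContDiff ℝ 1 u)
    (hv : ContDiff ℝ 1 v) (hw : Continuous w) : Continuous (bhatDensity u v w) := by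
  have h1 := continuous_pderiv2_component hu
  have h2 := continuous_pderiv2_component hv
  have h3 := hu.continuous
  have h4 := hv.continuous
  unfold bhatDensity
  fun_prop

lemma integrable_bhatDensity {u v w : (Fin 2 → ℝ) → (Fin 2 → ℝ)} (hu : ContDiff ℝ 1 u)
    (hv : ContDiff ℝ 1 v) (hw : Continuous w) (hws : HasCompactSupport w) :
    Integrable (bhatDensity u v w) :=
  (continuous_bhatDensity hu hv hw).integrable_of_hasCompactSupport
    (HasCompactSupport.intro hws fun x hx => by
      simp [bhatDensity, image_eq_zero_of_notMem_tsupport hx])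

lemma bhat_eq_integral_bhatDensity {u v w : (Fin 2 → ℝ) → (Fin 2 → ℝ)} (hu : ContDiff ℝ 1 u)
    (hv : ContDiff ℝ 1 v) (hw : Continuous w) (hws : HasCompactSupport w) :
    bhat u v w = ∫ x, bhatDensity u v w x := by
  have h1 := continuous_pderiv2_component hu
  have h2 := continuous_pderiv2_component hv
  have h3 := hu.continuous
  have h4 := hv.continuous
  simp only [bhatDensity]
  rw [integral_add, integral_const_mul, bhat]
  · exact Continuous.integrable_of_hasCompactSupport (by fun_prop)
      (HasCompactSupport.intro hws fun x hx => by simp [image_eq_zero_of_notMem_tsupport hx])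
  · exact Continuous.integrable_of_hasCompactSupport (by fun_prop)
      (HasCompactSupport.intro hws fun x hx => by simp [image_eq_zero_of_notMem_tsupport hx])

/-- Skew-symmetry of the trilinear form turns the difference of the two nonlinear terms into a
single term without derivatives of `w`. -/
lemma bhat_sub_bhat_eq_neg {u w : (Fin 2 → ℝ) → (Fin 2 → ℝ)} (hu : ContDiff ℝ 1 u)
    (hw : ContDiff ℝ 1 w) (hus : HasCompactSupport u) (hws : HasCompactSupport w) :
    bhat u u (u - w) - bhat w w (u - w) = -∫ x, bhatDensity (u - w) (u - w) w x := by
  have hz : ContDiff ℝ 1 (u - w) := hu.sub hw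
  have hzs : HasCompactSupport (u - w) := hus.sub hws
  have hdu (i) : Differentiable ℝ (fun y => u y i) :=
    (contDiff_component hu i).differentiable one_ne_zero
  have hdw (i) : Differentiable ℝ (fun y => w y i) :=
    (contDiff_component hw i).differentiable one_ne_zero
  have hcu := contDiff_component hu
  have hcw := contDiff_component hw
  let P (j : Fin 2) (x : Fin 2 → ℝ) : ℝ :=
    u x j * ((1 / 2) * ((u x 0 - w x 0) * (u x 0 - w x 0) + (u x 1 - w x 1) * (u x 1 - w x 1))) +
      (u x j - w x j) * ((u x 0 - w x 0) * w x 0 + (u x 1 - w x 1) * w x 1)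
  have hP (j) : ContDiff ℝ 1 (P j) := by
    have h0 := hcu j
    have h1 := hcw j
    have h2 := hcu 0
    have h3 := hcw 0
    have h4 := hcu 1
    have h5 := hcw 1
    fun_prop
  have hPs (j) : HasCompactSupport (P j) := HasCompactSupport.intro hzs fun x hx => by
    have h (i) : u x i - w x i = 0 := congrFun (image_eq_zero_of_notMem_tsupport hx) i
    simp [P, h]
  have hPi (j) : Integrable (pderiv2 j (P j)) :=
    (continuous_pderiv2 (hP j) j).integrable_of_hasCompactSupport
      (HasCompactSupport.intro (hPs j) fun x hx => pderiv2_eq_zero_of_notMem_tsupport hx j)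
  have hpt (x) : bhatDensity u u (u - w) x - bhatDensity w w (u - w) x +
      bhatDensity (u - w) (u - w) w x = pderiv2 0 (P 0) x + pderiv2 1 (P 1) x := by
    have hc (j) : pderiv2 j (fun _ => (1 / 2 : ℝ)) x = 0 := by simp [pderiv2]
    have hsub (i j) : pderiv2 j (fun y => u y i - w y i) x =
        pderiv2 j (fun y => u y i) x - pderiv2 j (fun y => w y i) x :=
      pderiv2_sub (hdu i) (hdw i) j x
    have hPj (j) : pderiv2 j (P j) x =
        u x j * ((u x 0 - w x 0) * (pderiv2 j (fun y => u y 0) x - pderiv2 j (fun y => w y 0) x) +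
          (u x 1 - w x 1) * (pderiv2 j (fun y => u y 1) x - pderiv2 j (fun y => w y 1) x)) +
        pderiv2 j (fun y => u y j) x *
          ((1 / 2) * ((u x 0 - w x 0) ^ 2 + (u x 1 - w x 1) ^ 2)) +
        (u x j - w x j) * ((u x 0 - w x 0) * pderiv2 j (fun y => w y 0) x +
          (pderiv2 j (fun y => u y 0) x - pderiv2 j (fun y => w y 0) x) * w x 0 +
          ((u x 1 - w x 1) * pderiv2 j (fun y => w y 1) x +
          (pderiv2 j (fun y => u y 1) x - pderiv2 j (fun y => w y 1) x) * w x 1)) +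
        (pderiv2 j (fun y => u y j) x - pderiv2 j (fun y => w y j) x) *
          ((u x 0 - w x 0) * w x 0 + (u x 1 - w x 1) * w x 1) := by
      have a0 := hdu 0
      have a1 := hdu 1
      have a2 := hdw 0
      have a3 := hdw 1
      have a4 := hdu j
      have a5 := hdw j
      simp only [P]
      rw [pderiv2_add (by fun_prop) (by fun_prop), pderiv2_mul (by fun_prop) (by fun_prop),
        pderiv2_mul (by fun_prop) (by fun_prop), pderiv2_mul (by fun_prop) (by fun_prop),
        pderiv2_add (by fun_prop) (by fun_prop), pderiv2_add (by fun_prop) (by fun_prop),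
        pderiv2_mul (by fun_prop) (by fun_prop), pderiv2_mul (by fun_prop) (by fun_prop),
        pderiv2_mul (by fun_prop) (by fun_prop), pderiv2_mul (by fun_prop) (by fun_prop),
        hc, hsub, hsub, hsub]
      ring
    rw [hPj, hPj]
    simp only [bhatDensity, Fin.sum_univ_two, Pi.sub_apply, hsub]
    ring
  have hint : ∫ x, (bhatDensity u u (u - w) x - bhatDensity w w (u - w) x +
      bhatDensity (u - w) (u - w) w x) = 0 := by
    simp only [hpt]
    rw [integral_add (hPi 0) (hPi 1), integral_pderiv2_eq_zero (hP 0) (hPs 0),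
      integral_pderiv2_eq_zero (hP 1) (hPs 1), add_zero]
  have i1 := integrable_bhatDensity hu hu hz.continuous hzs
  have i2 := integrable_bhatDensity hw hw hz.continuous hzs
  have i3 := integrable_bhatDensity hz hz hw.continuous hws
  rw [integral_add (by exact i1.sub i2) i3, integral_sub i1 i2] at hint
  rw [bhat_eq_integral_bhatDensity hu hu hz.continuous hzs,
    bhat_eq_integral_bhatDensity hw hw hz.continuous hzs]
  linarith

lemma bhatDensity_le (z w : (Fin 2 → ℝ) → (Fin 2 → ℝ)) (x : Fin 2 → ℝ) :
    bhatDensity z z w x ≤ 8 / 5 * (vecLength w x * vecLength z x * gradLength z x) := by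
  have h0 : 0 ≤ vecLength w x * vecLength z x * gradLength z x :=
    mul_nonneg (mul_nonneg (Real.sqrt_nonneg _) (Real.sqrt_nonneg _)) (Real.sqrt_nonneg _)
  refine le_of_abs_le (abs_le_of_sq_le_sq ?_ (by positivity))
  rw [mul_pow, mul_pow, mul_pow, vecLength_sq, vecLength_sq, gradLength_sq]
  let s := ∑ i : Fin 2, z x i * w x i
  let A (p : Fin 2 × Fin 2) : ℝ := w x p.1 * z x p.2 + if p.1 = p.2 then s / 2 else 0
  let M (p : Fin 2 × Fin 2) : ℝ := pderiv2 p.2 (fun y => z y p.1) x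
  have hb : bhatDensity z z w x = ∑ p, A p * M p := by
    simp only [bhatDensity, A, M, s, Fintype.sum_prod_type, Fin.sum_univ_two]
    simp
    ring
  have hA : ∑ p, A p ^ 2 ≤ 64 / 25 * ((∑ i : Fin 2, w x i ^ 2) * ∑ i : Fin 2, z x i ^ 2) := by
    simp only [A, s, Fintype.sum_prod_type, Fin.sum_univ_two]
    simp
    nlinarith [sq_nonneg (z x 0 * w x 1 - z x 1 * w x 0), sq_nonneg (z x 0 * w x 0 + z x 1 * w x 1)]
  rw [hb]
  refine (Finset.sum_mul_sq_le_sq_mul_sq _ _ _).trans ?_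
  have hM : ∑ p, M p ^ 2 = ∑ i : Fin 2, ∑ j : Fin 2, pderiv2 j (fun y => z y i) x ^ 2 := by
    simp only [M, Fintype.sum_prod_type]
  rw [hM]
  refine (mul_le_mul_of_nonneg_right hA (by positivity)).trans_eq (by ring)

lemma le_add_of_sq_le_four_mul {a b c : ℝ} (hb : 0 ≤ b) (hc : 0 ≤ c) (h : a ^ 2 ≤ 4 * b * c) :
    a ≤ b + c :=
  le_of_abs_le (abs_le_of_sq_le_sq (by nlinarith [sq_nonneg (b - c)]) (by positivity))

lemma integral_bhatDensity_le {ν : ℝ} (hν : 0 < ν) {z w : (Fin 2 → ℝ) → (Fin 2 → ℝ)}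
    (hz : ContDiff ℝ 1 z) (hw : ContDiff ℝ 1 w) (hzs : HasCompactSupport z)
    (hws : HasCompactSupport w) :
    ∫ x, bhatDensity z z w x ≤
      ν / 2 * gradL2normSq z + 27 / (2 * ν ^ 3) * l4normP4 w * l2normSq z := by
  have cz := continuous_vecLength hz.continuous
  have cw := continuous_vecLength hw.continuous
  have cg := continuous_gradLength hz
  have sz := hasCompactSupport_vecLength hzs
  have sw := hasCompactSupport_vecLength hws
  have sg := hasCompactSupport_gradLength hzs
  have hL := l4normP4_le hz hzs
  have hT := sq_integral_mul_le (cw.mul cz) sz.mul_left cg sg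
  have hB := sq_integral_mul_le (cw.pow 2) sw.fun_sq (cz.pow 2) sz.fun_sq
  simp only [Pi.mul_apply, Pi.pow_apply, mul_pow] at hT hB
  have hI : ∫ x, bhatDensity z z w x ≤
      8 / 5 * ∫ x, vecLength w x * vecLength z x * gradLength z x := by
    rw [← integral_const_mul]
    exact integral_mono (integrable_bhatDensity hz hz hw.continuous hws)
      ((((cw.mul cz).mul cg).integrable_of_hasCompactSupport sg.mul_left).const_mul _)
      (bhatDensity_le z w)
  rw [← l4normP4_eq_integral_vecLength_sq_sq, ← l4normP4_eq_integral_vecLength_sq_sq] at hB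
  rw [← gradL2normSq_eq_integral_gradLength_sq hz hzs] at hT
  have hG0 : 0 ≤ gradL2normSq z :=
    Finset.sum_nonneg fun i _ => Finset.sum_nonneg fun j _ => integral_nonneg fun x => sq_nonneg _
  have hW0 : 0 ≤ l4normP4 w := integral_nonneg fun x => sq_nonneg _
  have hZ0 : 0 ≤ l2normSq z := integral_nonneg fun x => Finset.sum_nonneg fun i _ => sq_nonneg _
  have hB0 : 0 ≤ ∫ x, vecLength w x ^ 2 * vecLength z x ^ 2 :=
    integral_nonneg fun x => mul_nonneg (sq_nonneg _) (sq_nonneg _)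
  generalize gradL2normSq z = G at *
  generalize l4normP4 w = W at *
  generalize l2normSq z = Z at *
  generalize ∫ x, vecLength w x ^ 2 * vecLength z x ^ 2 = B at *
  generalize ∫ x, vecLength w x * vecLength z x * gradLength z x = T at *
  have hB' : B ^ 2 ≤ W * (Z * G) := hB.trans (by gcongr)
  have h1 : 8 / 5 * T ≤ ν / 4 * G + 64 / 25 / ν * B := by
    refine le_add_of_sq_le_four_mul (by positivity) (by positivity) ?_
    have : 4 * (ν / 4 * G) * (64 / 25 / ν * B) = 64 / 25 * (B * G) := by field_simp
    rw [this]
    linarith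
  have h2 : 64 / 25 / ν * B ≤ ν / 4 * G + (64 / 25) ^ 2 / ν ^ 3 * (W * Z) := by
    refine le_add_of_sq_le_four_mul (by positivity) (by positivity) ?_
    have : 4 * (ν / 4 * G) * ((64 / 25) ^ 2 / ν ^ 3 * (W * Z)) =
        (64 / 25 / ν) ^ 2 * (W * (Z * G)) := by field_simp
    rw [this, mul_pow]
    gcongr
  have h3 : (64 / 25) ^ 2 / ν ^ 3 * (W * Z) ≤ 27 / (2 * ν ^ 3) * W * Z := by
    rw [mul_assoc, ← div_div]
    gcongr
    norm_num
  linarith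

/-- Local monotonicity (Menaldi–Sritharan, Lemma 2.4): with `z = u − w`,
`ν‖∇z‖² + b̂(u,u,z) − b̂(w,w,z) + (27/(2ν³))‖w‖_{L⁴}⁴‖z‖_{L²}² ≥ (ν/2)‖∇z‖²`. -/
theorem local_monotonicity (ν : ℝ) (hν : 0 < ν)
    (u w : (Fin 2 → ℝ) → (Fin 2 → ℝ))
    (hu : ContDiff ℝ (⊤ : ℕ∞) u) (hw : ContDiff ℝ (⊤ : ℕ∞) w)
    (hus : HasCompactSupport u) (hws : HasCompactSupport w) :
    (ν / 2) * gradL2normSq (u - w) ≤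
      ν * gradL2normSq (u - w) + bhat u u (u - w) - bhat w w (u - w) +
        (27 / (2 * ν ^ 3)) * l4normP4 w * l2normSq (u - w) := by
  have hu1 : ContDiff ℝ 1 u := hu.of_le (by exact_mod_cast le_top)
  have hw1 : ContDiff ℝ 1 w := hw.of_le (by exact_mod_cast le_top)
  have h1 := bhat_sub_bhat_eq_neg hu1 hw1 hus hws
  have h2 := integral_bhatDensity_le (z := u - w) hν (hu1.sub hw1) hw1 (hus.sub hws) hws
  linarith
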